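/- Assume r_j ≤ 1 for all outcomes j. There is an absolute constant A > 0 such that for every 0 < ε < 1 there exists a finite class B ⊆ C_bounded = [0,1]^m that is an ε-approximation of C_bounded and satisfies log₂|B| ≤ A·m·(log₂(1/ε) + log₂ m + 1); in particular PDim(B) ≤ A·m·(log₂(1/ε) + log₂ m + 1). -/

import Mathlib

open scoped BigOperators

/-- An agent type in the hidden-action principal-agent model with `n` actions and
`m` outcomes: a production function `f` (a distribution over outcomes for each action)
and a nonnegative cost vector `c` with `c 0 = 0`. -/
structure AgentType (n m : ℕ) where
  f : Fin n → Fin m → ℝ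
  c : Fin n → ℝ
  f_nonneg : ∀ i j, 0 ≤ f i j
  f_sum : ∀ i, ∑ j, f i j = 1
  c_nonneg : ∀ i, 0 ≤ c i
  c_zero : ∀ i : Fin n, (i : ℕ) = 0 → c i = 0

/-- The agent's expected utility for action `i` under contract `t`. -/
def uA {n m : ℕ} (θ : AgentType n m) (t : Fin m → ℝ) (i : Fin n) : ℝ :=
  (∑ j, θ.f i j * t j) - θ.c i

/-- The principal's expected utility when the agent takes action `i` under contract `t`,
with rewards `r`. -/
def uPa {n m : ℕ} (r : Fin m → ℝ) (θ : AgentType n m) (t : Fin m → ℝ) (i : Fin n) : ℝ :=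
  ∑ j, θ.f i j * (r j - t j)

/-- The set of the agent's best-response actions to contract `t`. -/
def BestResp {n m : ℕ} (θ : AgentType n m) (t : Fin m → ℝ) : Set (Fin n) :=
  {i | ∀ i', uA θ t i' ≤ uA θ t i}

/-- The principal's utility under contract `t`: the agent best-responds, breaking ties
in favor of the principal. -/
noncomputable def uP {n m : ℕ} (r : Fin m → ℝ) (θ : AgentType n m) (t : Fin m → ℝ) : ℝ :=
  sSup (uPa r θ t '' BestResp θ t)

/-- The class of linear contracts `α • r`, `α ∈ [0,1]`. -/
def Clinear {m : ℕ} (r : Fin m → ℝ) : Set (Fin m → ℝ) :=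
  {t | ∃ α : ℝ, α ∈ Set.Icc (0:ℝ) 1 ∧ t = fun j => α * r j}

/-- The class of bounded contracts `[0,1]^m`. -/
def Cbounded (m : ℕ) : Set (Fin m → ℝ) := {t | ∀ j, t j ∈ Set.Icc (0:ℝ) 1}

/-- The class of unbounded contracts `ℝ_{≥0}^m`. -/
def Cunbounded (m : ℕ) : Set (Fin m → ℝ) := {t | ∀ j, 0 ≤ t j}

/-- A finitely supported probability distribution. -/
structure FinDist (α : Type*) where
  p : α → ℝ
  nonneg : ∀ a, 0 ≤ p a
  finite_support : (Function.support p).Finite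
  total : ∑ᶠ a, p a = 1

/-- Expectation of `g` under a finitely supported distribution `D`. -/
noncomputable def expect {α : Type*} (D : FinDist α) (g : α → ℝ) : ℝ :=
  ∑ᶠ a, D.p a * g a

/-- `OPT(C, D)`: the supremum over contracts in `C` of the principal's expected utility. -/
noncomputable def OPT {n m : ℕ} (C : Set (Fin m → ℝ)) (r : Fin m → ℝ)
    (D : FinDist (AgentType n m)) : ℝ :=
  sSup ((fun t => expect D (fun θ => uP r θ t)) '' C)

/-- Pseudo-dimension shattering: `C` shatters some `k` types in `Θ`. -/
def Shatters {n m : ℕ} (r : Fin m → ℝ) (C : Set (Fin m → ℝ))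
    (Θ : Set (AgentType n m)) (k : ℕ) : Prop :=
  ∃ θ : Fin k → AgentType n m, (∀ j, θ j ∈ Θ) ∧ ∃ τ : Fin k → ℝ,
    ∀ S : Finset (Fin k), ∃ t ∈ C,
      (∀ j, j ∈ S → τ j ≤ uP r (θ j) t) ∧ (∀ j, j ∉ S → uP r (θ j) t < τ j)

/-- `Cbar` is an `ε`-approximation of `C` (representation error at most `ε`). -/
def IsApprox (n : ℕ) {m : ℕ} (r : Fin m → ℝ) (Cbar C : Set (Fin m → ℝ)) (ε : ℝ) : Prop :=
  ∀ D : FinDist (AgentType n m), OPT Cbar r D ≥ OPT C r D - ε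

/-- Best responses breaking ties in favor of the principal. -/
def BestRespP {n m : ℕ} (r : Fin m → ℝ) (θ : AgentType n m) (t : Fin m → ℝ) : Set (Fin n) :=
  {i | i ∈ BestResp θ t ∧ ∀ i' ∈ BestResp θ t, uPa r θ t i' ≤ uPa r θ t i}

/-- Principal's expected reward under the linear contract `α • r`. -/
noncomputable def rP {n m : ℕ} (r : Fin m → ℝ) (θ : AgentType n m) (α : ℝ) : ℝ :=
  sSup ((fun i => ∑ j, θ.f i j * r j) '' BestRespP r θ (fun j => α * r j))

/-- The set of critical values of an agent type for linear contracts. -/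
def CritSet {n m : ℕ} (r : Fin m → ℝ) (θ : AgentType n m) : Set ℝ :=
  {α | α ∈ Set.Ioc (0:ℝ) 1 ∧ ∀ ε : ℝ, 0 < ε → ε ≤ α → rP r θ (α - ε) ≠ rP r θ α}

/-- Probability of the event `E` under `N` i.i.d. samples from `D`. -/
noncomputable def prodProb {α : Type*} (D : FinDist α) (N : ℕ) (E : Set (Fin N → α)) : ℝ :=
  ∑ᶠ s ∈ E, ∏ i, D.p (s i)

/-- The class of `ε`-discrete linear contracts. -/
def Leps {m : ℕ} (r : Fin m → ℝ) (ε : ℝ) : Set (Fin m → ℝ) :=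
  {t | ∃ α : ℝ, ((∃ k : ℕ, α = k * ε ∧ k * ε ≤ 1) ∨ α = 1) ∧ t = fun j => α * r j}

theorem exists_bestResp {n m : ℕ} (hn : 1 ≤ n) (θ : AgentType n m) (t : Fin m → ℝ) :
    (BestResp θ t).Nonempty := by
  have : Nonempty (Fin n) := ⟨⟨0, hn⟩⟩
  obtain ⟨i, hi⟩ := Finite.exists_max (uA θ t)
  exact ⟨i, hi⟩

theorem exists_uP_eq {n m : ℕ} (hn : 1 ≤ n) (r : Fin m → ℝ) (θ : AgentType n m)
    (t : Fin m → ℝ) : ∃ i ∈ BestResp θ t, uP r θ t = uPa r θ t i := by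
  obtain ⟨i, hi, h⟩ := ((exists_bestResp hn θ t).image (uPa r θ t)).csSup_mem
    (Set.toFinite _)
  exact ⟨i, hi, h.symm⟩

theorem uPa_le_uP {n m : ℕ} (r : Fin m → ℝ) (θ : AgentType n m) (t : Fin m → ℝ)
    {i : Fin n} (hi : i ∈ BestResp θ t) : uPa r θ t i ≤ uP r θ t :=
  le_csSup (Set.toFinite _).bddAbove (Set.mem_image_of_mem _ hi)

theorem AgentType.abs_sum_mul_le {n m : ℕ} (θ : AgentType n m) (i : Fin n) {v : Fin m → ℝ}
    {b : ℝ} (hv : ∀ j, |v j| ≤ b) : |∑ j, θ.f i j * v j| ≤ b :=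
  calc |∑ j, θ.f i j * v j| ≤ ∑ j, |θ.f i j * v j| := Finset.abs_sum_le_sum_abs _ _
    _ ≤ ∑ j, θ.f i j * b := Finset.sum_le_sum fun j _ => by
        rw [abs_mul, abs_of_nonneg (θ.f_nonneg i j)]
        exact mul_le_mul_of_nonneg_left (hv j) (θ.f_nonneg i j)
    _ = b := by rw [← Finset.sum_mul, θ.f_sum, one_mul]

/-- Moving a contract `t` a fraction `δ` towards `r`, and then by at most `η` in every
coordinate, costs the principal at most `2 η / δ + δ + η`. -/
theorem uP_le_uP_add {n m : ℕ} (hn : 1 ≤ n) {r t s : Fin m → ℝ} {δ η : ℝ} (hδ : 0 < δ)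
    (hrt : ∀ j, |r j - t j| ≤ 1) (hs : ∀ j, |s j - (t j + δ * (r j - t j))| ≤ η)
    (θ : AgentType n m) : uP r θ t ≤ uP r θ s + (2 * η / δ + δ + η) := by
  obtain ⟨i, hi, hti⟩ := exists_uP_eq hn r θ t
  obtain ⟨k, hk⟩ := exists_bestResp hn θ s
  have hsk := uPa_le_uP r θ s hk
  have h₁ := hi k
  have h₂ := hk i
  have ei := abs_le.1 (θ.abs_sum_mul_le i hs)
  have ek := abs_le.1 (θ.abs_sum_mul_le k hs)
  have bk := abs_le.1 (θ.abs_sum_mul_le k hrt)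
  have expand (l : Fin n) : ∑ j, θ.f l j * (s j - (t j + δ * (r j - t j))) =
      ∑ j, θ.f l j * s j - ∑ j, θ.f l j * t j - δ * uPa r θ t l := by
    rw [uPa, Finset.mul_sum, ← Finset.sum_sub_distrib, ← Finset.sum_sub_distrib]
    exact Finset.sum_congr rfl fun j _ => by ring
  have expand' : uPa r θ s k = uPa r θ t k - (∑ j, θ.f k j * s j - ∑ j, θ.f k j * t j) := by
    simp only [uPa, ← Finset.sum_sub_distrib]
    exact Finset.sum_congr rfl fun j _ => by ring
  rw [expand] at ei ek
  change -1 ≤ uPa r θ t k ∧ uPa r θ t k ≤ 1 at bk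
  simp only [uA] at h₁ h₂
  have loss : uPa r θ t i - uPa r θ t k ≤ 2 * η / δ := by
    rw [le_div_iff₀ hδ]
    linarith
  have hδk : δ * uPa r θ t k ≤ δ := by nlinarith [bk.2]
  linarith

theorem expect_le_expect_add {α : Type*} (D : FinDist α) {g h : α → ℝ} {ε : ℝ}
    (hgh : ∀ a, g a ≤ h a + ε) : expect D g ≤ expect D h + ε := by
  have sum_eq (u : α → ℝ) :
      expect D u = ∑ a ∈ D.finite_support.toFinset, D.p a * u a :=
    finsum_eq_sum_of_support_subset _ fun a ha => by
      simpa using left_ne_zero_of_mul (Function.mem_support.1 ha)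
  have total : ∑ a ∈ D.finite_support.toFinset, D.p a = 1 := by
    rw [← D.total, finsum_eq_sum D.p D.finite_support]
  rw [sum_eq, sum_eq]
  calc _ ≤ ∑ a ∈ D.finite_support.toFinset, (D.p a * h a + D.p a * ε) :=
        Finset.sum_le_sum fun a _ => by
          rw [← mul_add]
          exact mul_le_mul_of_nonneg_left (hgh a) (D.nonneg a)
    _ = _ := by rw [Finset.sum_add_distrib, ← Finset.sum_mul, total, one_mul]

/-- A finite class is an `ε`-approximation as soon as every contract is dominated, up to `ε`
and uniformly over all types, by one of its members. -/
theorem isApprox_of_forall_exists {n m : ℕ} {r : Fin m → ℝ} {B C : Set (Fin m → ℝ)} {ε : ℝ}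
    (hB : B.Finite) (hC : C.Nonempty)
    (h : ∀ t ∈ C, ∃ s ∈ B, ∀ θ : AgentType n m, uP r θ t ≤ uP r θ s + ε) :
    IsApprox n r B C ε := by
  intro D
  rw [ge_iff_le, sub_le_iff_le_add]
  refine csSup_le (hC.image _) ?_
  rintro _ ⟨t, ht, rfl⟩
  obtain ⟨s, hs, hts⟩ := h t ht
  exact (expect_le_expect_add D hts).trans <| by
    gcongr
    exact le_csSup (hB.image _).bddAbove (Set.mem_image_of_mem _ hs)

theorem Shatters.two_pow_le_ncard {n m d : ℕ} {r : Fin m → ℝ} {B : Set (Fin m → ℝ)}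
    {Θ : Set (AgentType n m)} (hB : B.Finite) (h : Shatters r B Θ d) : 2 ^ d ≤ B.ncard := by
  obtain ⟨θ, -, τ, h⟩ := h
  choose t htB hin hout using h
  have sub {S T : Finset (Fin d)} (hST : t S = t T) : S ⊆ T := by
    intro j hj
    by_contra hjT
    exact absurd (hin S j hj) (not_le.2 (hST ▸ hout T j hjT))
  have inj : Function.Injective t := fun S T hST => (sub hST).antisymm (sub hST.symm)
  have := Set.ncard_le_ncard (Set.range_subset_iff.2 htB) hB
  rwa [← Set.image_univ, Set.ncard_image_of_injective _ inj, Set.ncard_univ,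
    Nat.card_eq_fintype_card, Fintype.card_finset, Fintype.card_fin] at this

/-- The contracts all of whose payments are multiples of `1 / N` in `[0, 1]`. -/
def gridContracts (m N : ℕ) : Set (Fin m → ℝ) :=
  Set.range fun (k : Fin m → Fin (N + 1)) j => ((k j : ℕ) : ℝ) / N

theorem gridContracts_finite (m N : ℕ) : (gridContracts m N).Finite := Set.finite_range _

theorem gridContracts_nonempty (m N : ℕ) : (gridContracts m N).Nonempty := Set.range_nonempty _

theorem gridContracts_subset (m N : ℕ) : gridContracts m N ⊆ Cbounded m := by
  rintro _ ⟨k, rfl⟩ j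
  exact ⟨by positivity, div_le_one_of_le₀ (by exact_mod_cast (k j).is_le) (by positivity)⟩

theorem gridContracts_ncard_le (m N : ℕ) : (gridContracts m N).ncard ≤ (N + 1) ^ m := by
  rw [gridContracts, ← Set.image_univ]
  refine (Set.ncard_image_le Set.finite_univ).trans ?_
  simp [Set.ncard_univ]

theorem exists_gridContracts_near {m N : ℕ} (hN : 0 < N) {t : Fin m → ℝ}
    (ht : t ∈ Cbounded m) : ∃ s ∈ gridContracts m N, ∀ j, |s j - t j| ≤ 1 / N := by
  have hN' : (0 : ℝ) < N := by exact_mod_cast hN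
  have hle (j : Fin m) : ⌊t j * N⌋₊ < N + 1 :=
    Nat.lt_succ_of_le (Nat.floor_le_of_le (by nlinarith [(ht j).2]))
  refine ⟨_, ⟨fun j => ⟨⌊t j * N⌋₊, hle j⟩, rfl⟩, fun j => ?_⟩
  have h₁ := Nat.floor_le (mul_nonneg (ht j).1 hN'.le)
  have h₂ := Nat.lt_floor_add_one (t j * N)
  have : (⌊t j * N⌋₊ : ℝ) / N - t j = (⌊t j * N⌋₊ - t j * N) / N := by field_simp
  rw [this, abs_div, abs_of_pos hN']
  gcongr
  rw [abs_le]
  constructor <;> linarith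

theorem gridContracts_isApprox {n m N : ℕ} (hn : 1 ≤ n) {r : Fin m → ℝ} (hr : r ∈ Cbounded m)
    {ε : ℝ} (hε : 0 < ε) (hε₁ : ε < 1) (hN : 16 / ε ^ 2 ≤ N) :
    IsApprox n r (gridContracts m N) (Cbounded m) ε := by
  have hN₀ : (0 : ℝ) < N := lt_of_lt_of_le (by positivity) hN
  have hη : 1 / (N : ℝ) ≤ ε ^ 2 / 16 := by
    rw [div_le_iff₀ hN₀]
    rw [div_le_iff₀ (by positivity)] at hN
    linarith
  refine isApprox_of_forall_exists (gridContracts_finite m N) ⟨r, hr⟩ fun t ht => ?_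
  have mem : (fun j => t j + ε / 2 * (r j - t j)) ∈ Cbounded m := fun j => by
    obtain ⟨h₁, h₂⟩ := ht j
    obtain ⟨h₃, h₄⟩ := hr j
    constructor <;> nlinarith
  obtain ⟨s, hs, near⟩ := exists_gridContracts_near (by exact_mod_cast hN₀) mem
  refine ⟨s, hs, fun θ => ?_⟩
  refine (uP_le_uP_add hn (half_pos hε) (fun j => ?_)
    (fun j => (near j).trans hη) θ).trans ?_
  · rw [abs_le]
    constructor <;> linarith [(ht j).1, (ht j).2, (hr j).1, (hr j).2]
  · have : 2 * (ε ^ 2 / 16) / (ε / 2) = ε / 4 := by field_simp; norm_num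
    rw [this]
    nlinarith

theorem logb_gridContracts_ncard_le {m N : ℕ} {ε : ℝ} (hε : 0 < ε)
    (hN : (N : ℝ) + 1 ≤ 32 / ε ^ 2) :
    Real.logb 2 (gridContracts m N).ncard ≤ m * (5 + 2 * Real.logb 2 (1 / ε)) := by
  have pos : (0 : ℝ) < (gridContracts m N).ncard := by
    exact_mod_cast (Set.ncard_pos (gridContracts_finite m N)).2 (gridContracts_nonempty m N)
  calc Real.logb 2 (gridContracts m N).ncard ≤ Real.logb 2 (((N : ℝ) + 1) ^ m) :=
        Real.logb_le_logb_of_le one_lt_two pos (by exact_mod_cast gridContracts_ncard_le m N)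
    _ = m * Real.logb 2 ((N : ℝ) + 1) := Real.logb_pow _ _ _
    _ ≤ m * Real.logb 2 (2 ^ 5 * (1 / ε) ^ 2) := by
        gcongr
        · norm_num
        · exact hN.trans_eq (by ring)
    _ = _ := by
        rw [Real.logb_mul (by positivity) (by positivity), Real.logb_pow, Real.logb_pow,
          Real.logb_self_eq_one one_lt_two]
        norm_num

/-- Assuming all rewards are at most `1`, there is an absolute constant
`A > 0` such that for every `0 < ε < 1` there is a finite class `B ⊆ C_bounded` that is
an `ε`-approximation of `C_bounded` with `log₂|B| ≤ A·m·(log₂(1/ε) + log₂ m + 1)`;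
in particular `PDim(B)` obeys the same bound. -/
theorem stmt_5 : ∃ A : ℝ, 0 < A ∧
    ∀ (n m : ℕ), 1 ≤ n → 2 ≤ m → ∀ r : Fin m → ℝ,
      (∀ j, 0 ≤ r j) → (∀ j : Fin m, (j : ℕ) = 0 → r j = 0) → (∀ j, r j ≤ 1) →
      ∀ ε : ℝ, 0 < ε → ε < 1 →
        ∃ B : Set (Fin m → ℝ), B ⊆ Cbounded m ∧ B.Finite ∧
          IsApprox n r B (Cbounded m) ε ∧
          Real.logb 2 (B.ncard) ≤ A * m * (Real.logb 2 (1/ε) + Real.logb 2 m + 1) ∧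
          (∀ d : ℕ, Shatters r B (Set.univ : Set (AgentType n m)) d →
            (d : ℝ) ≤ A * m * (Real.logb 2 (1/ε) + Real.logb 2 m + 1)) := by
  refine ⟨5, by norm_num, fun n m hn hm r hr₀ _ hr₁ ε hε hε₁ => ?_⟩
  have hε₂ : 1 ≤ 1 / ε ^ 2 := one_le_one_div (by positivity) (by nlinarith)
  set N := ⌈16 / ε ^ 2⌉₊
  have hN_lt : (N : ℝ) < 16 / ε ^ 2 + 1 := Nat.ceil_lt_add_one (by positivity)
  have card : Real.logb 2 (gridContracts m N).ncard ≤
      5 * m * (Real.logb 2 (1 / ε) + Real.logb 2 m + 1) := by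
    have h₁ := logb_gridContracts_ncard_le (m := m) (N := N) hε (by
      have h₁₆ : 16 / ε ^ 2 = 16 * (1 / ε ^ 2) := by ring
      have h₃₂ : 32 / ε ^ 2 = 32 * (1 / ε ^ 2) := by ring
      linarith)
    have hlogε : 0 ≤ Real.logb 2 (1 / ε) :=
      Real.logb_nonneg one_lt_two (one_le_one_div hε hε₁.le)
    have hlogm : 0 ≤ Real.logb 2 m :=
      Real.logb_nonneg one_lt_two (by exact_mod_cast one_le_two.trans hm)
    have h₂ : (m : ℝ) * (5 + 2 * Real.logb 2 (1 / ε)) ≤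
        m * (5 * (Real.logb 2 (1 / ε) + Real.logb 2 m + 1)) := by
      gcongr
      linarith
    linarith
  refine ⟨gridContracts m N, gridContracts_subset m N, gridContracts_finite m N,
    gridContracts_isApprox hn (fun j => ⟨hr₀ j, hr₁ j⟩) hε hε₁ (Nat.le_ceil _), card,
    fun d hd => le_trans ?_ card⟩
  have two_pow : ((2 : ℝ) ^ d) ≤ (gridContracts m N).ncard := by
    exact_mod_cast hd.two_pow_le_ncard (gridContracts_finite m N)
  rw [Real.le_logb_iff_rpow_le one_lt_two (lt_of_lt_of_le (by positivity) two_pow),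
    Real.rpow_natCast]
  exact two_pow
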